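/- arXiv:1107.1091 — 2 statements merged into one kernel-verified Lean document; each statement's English description precedes it below -/
import Mathlib

section
/- Let δ: L₁ → L₂ be a branched covering of finite laminations on the circle C = ℝ/2πℤ of degree d, let G be a gap of L₁, and let G' be the gap of L₂ with δ(cl(G)) = cl(G'). Then the ratio d·μ(G)/μ(G') is a positive integer m; moreover all but finitely many points of G' have exactly m preimages in G under δ (so m is the topological degree of δ restricted to G). -/
open Set MeasureTheory Filter Topology

noncomputable section

/-- The circle `ℝ/2πℤ`. -/
abbrev Circle2pi : Type := AddCircle (2 * Real.pi)

instance : Fact ((0 : ℝ) < 2 * Real.pi) := ⟨by positivity⟩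

/-- A finite lamination on the circle `ℝ/2πℤ`: an equivalence relation whose classes are
finite, all but finitely many of which are singletons, and whose distinct classes are
unlinked (equivalent pairs from distinct classes lie in a common connected component of the
complement of the other pair). -/
structure FiniteLamination where
  rel : Circle2pi → Circle2pi → Prop
  iseqv : Equivalence rel
  class_finite : ∀ x, {y | rel x y}.Finite
  nontrivial_finite : {x | ∃ y, rel x y ∧ y ≠ x}.Finite
  unlinked : ∀ a b c d : Circle2pi, rel a b → rel c d → ¬ rel a c → a ≠ b → c ≠ d →
    b ∈ connectedComponentIn ({c, d}ᶜ : Set Circle2pi) a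

/-- The equivalence class of `x` under the lamination `L`. -/
def FiniteLamination.cls (L : FiniteLamination) (x : Circle2pi) : Set Circle2pi :=
  {y | L.rel x y}

/-- `a` and `b` are adjacent (consecutive) in the cyclic order of the set `A`:
both belong to `A`, are distinct, and one of the two open arcs bounded by `a` and `b`
(i.e. one of the connected components of the complement of `{a, b}`) contains no point of `A`. -/
def AdjacentIn (A : Set Circle2pi) (a b : Circle2pi) : Prop :=
  a ∈ A ∧ b ∈ A ∧ a ≠ b ∧
    ∃ x ∈ ({a, b}ᶜ : Set Circle2pi),
      connectedComponentIn ({a, b}ᶜ : Set Circle2pi) x ∩ A = ∅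

/-- A branched covering of finite laminations: an affine degree `d ≥ 1` map
`t ↦ d • t + c` of the circle carrying each `L₁`-class exactly onto an `L₂`-class and
preserving consecutivity of points of a class whenever the image class is nontrivial. -/
structure LamBranchedCover (L₁ L₂ : FiniteLamination) where
  deg : ℕ
  deg_pos : 1 ≤ deg
  shift : Circle2pi
  maps_cls : ∀ x : Circle2pi,
    (fun t => deg • t + shift) '' L₁.cls x = L₂.cls (deg • x + shift)
  consecutive : ∀ x a b : Circle2pi,
    ¬ ((fun t => deg • t + shift) '' L₁.cls x).Subsingleton →
    AdjacentIn (L₁.cls x) a b →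
    AdjacentIn ((fun t => deg • t + shift) '' L₁.cls x) (deg • a + shift) (deg • b + shift)

/-- The underlying circle map of a branched covering of laminations. -/
def LamBranchedCover.map {L₁ L₂ : FiniteLamination} (δ : LamBranchedCover L₁ L₂) :
    Circle2pi → Circle2pi := fun t => δ.deg • t + δ.shift

/-- The set `S` is unlinked with every pair of `L`-equivalent points lying in a
nontrivial class. -/
def UnlinkedSet (L : FiniteLamination) (S : Set Circle2pi) : Prop :=
  ∀ a ∈ S, ∀ b ∈ S, ∀ c d : Circle2pi, L.rel c d → c ≠ d →
    b ∈ connectedComponentIn ({c, d}ᶜ : Set Circle2pi) a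

/-- A gap of the lamination `L`: a maximal open subset of the circle every pair of whose
points is unlinked with every pair of `L`-equivalent points in a nontrivial class. -/
def IsGapOf (L : FiniteLamination) (G : Set Circle2pi) : Prop :=
  IsOpen G ∧ G.Nonempty ∧ UnlinkedSet L G ∧
    ∀ G' : Set Circle2pi, IsOpen G' → UnlinkedSet L G' → G ⊆ G' → G = G'


lemma isOpen_coe_image_Ioo {T : ℝ} (c d : ℝ) : IsOpen (((↑) : ℝ → AddCircle T) '' Ioo c d) :=
  QuotientAddGroup.isOpenMap_coe _ isOpen_Ioo

lemma isPreconnected_coe_image_Ioo {T : ℝ} (c d : ℝ) :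
    IsPreconnected (((↑) : ℝ → AddCircle T) '' Ioo c d) :=
  isPreconnected_Ioo.image _ (AddCircle.continuous_mk' T).continuousOn

lemma exists_nsmul_add_eq {T : ℝ} {d : ℕ} (hd : 0 < d) (e y : AddCircle T) :
    ∃ x : AddCircle T, d • x + e = y := by
  obtain ⟨t, ht⟩ := QuotientAddGroup.mk_surjective (y - e)
  refine ⟨((t / d : ℝ) : AddCircle T), ?_⟩
  have hd' : (d : ℝ) ≠ 0 := by positivity
  rw [← AddCircle.coe_nsmul, nsmul_eq_mul, mul_div_cancel₀ _ hd', eq_comm, ← sub_eq_iff_eq_add]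
  exact ht.symm

section Arcs

variable {T : ℝ} [hT : Fact (0 < T)]

/-- The representative in `[s, s + T)` of a point of the circle `ℝ/Tℤ`. -/
def circleLift (s : ℝ) (x : AddCircle T) : ℝ := AddCircle.equivIco T s x

lemma coe_circleLift (s : ℝ) (x : AddCircle T) : (circleLift s x : AddCircle T) = x :=
  AddCircle.coe_equivIco

lemma circleLift_mem (s : ℝ) (x : AddCircle T) : circleLift s x ∈ Ico s (s + T) :=
  (AddCircle.equivIco T s x).2

lemma circleLift_coe {s t : ℝ} (ht : t ∈ Ico s (s + T)) :
    circleLift s (t : AddCircle T) = t := by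
  rw [circleLift, AddCircle.equivIco_coe_eq ht]

lemma circleLift_injective (s : ℝ) : Function.Injective (circleLift (T := T) s) := fun x y h => by
  rw [← coe_circleLift s x, h, coe_circleLift]

lemma mem_coe_image_iff {s : ℝ} {S : Set ℝ} (hS : S ⊆ Ico s (s + T)) (x : AddCircle T) :
    x ∈ ((↑) : ℝ → AddCircle T) '' S ↔ circleLift s x ∈ S := by
  constructor
  · rintro ⟨t, ht, rfl⟩
    rwa [circleLift_coe (hS ht)]
  · exact fun h => ⟨_, h, coe_circleLift s x⟩

/-- Removing two points from the circle leaves two open arcs. -/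
lemma mem_coe_image_Ioo_add_iff {c d : ℝ} (hcd : c < d) (hd : d < c + T) (x : AddCircle T) :
    x ∈ ((↑) : ℝ → AddCircle T) '' Ioo d (c + T) ↔
      x ≠ c ∧ x ≠ d ∧ x ∉ ((↑) : ℝ → AddCircle T) '' Ioo c d := by
  have hT' := hT.out
  rw [mem_coe_image_iff (s := c) (fun t ht => ⟨(hcd.trans ht.1).le, ht.2⟩),
    mem_coe_image_iff (s := c) (fun t ht => ⟨ht.1.le, ht.2.trans hd⟩)]
  have hc : x = c ↔ circleLift c x = c := by
    rw [← (circleLift_injective c).eq_iff, circleLift_coe (t := c) ⟨le_rfl, by linarith⟩]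
  have hd' : x = d ↔ circleLift c x = d := by
    rw [← (circleLift_injective c).eq_iff, circleLift_coe (t := d) ⟨hcd.le, hd⟩]
  have hx := circleLift_mem c x
  rw [Ne, Ne, hc, hd']
  simp only [mem_Ioo, mem_Ico] at hx ⊢
  constructor
  · rintro ⟨h1, h2⟩
    exact ⟨by linarith, h1.ne', fun h => by linarith [h.2]⟩
  · rintro ⟨h1, h2, h3⟩
    refine ⟨lt_of_le_of_ne (not_lt.1 fun h => h3 ⟨lt_of_le_of_ne hx.1 (Ne.symm h1), h⟩)
      (Ne.symm h2), hx.2⟩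

lemma connectedComponentIn_eq_coe_image_Ioo {c d : ℝ} (hcd : c < d) (hd : d < c + T)
    {a : AddCircle T} (ha : a ∈ ((↑) : ℝ → AddCircle T) '' Ioo c d) :
    connectedComponentIn ({(c : AddCircle T), (d : AddCircle T)}ᶜ) a
      = ((↑) : ℝ → AddCircle T) '' Ioo c d := by
  have hV := mem_coe_image_Ioo_add_iff (T := T) hcd hd
  have hsub : ((↑) : ℝ → AddCircle T) '' Ioo c d ⊆ {(c : AddCircle T), (d : AddCircle T)}ᶜ := by
    rintro x hx h
    have hU := mem_coe_image_Ioo_add_iff (T := T) hd (by linarith : c + T < d + T) x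
    rw [AddCircle.coe_add_period] at hU
    have hne : x ≠ d ∧ x ≠ c := by
      obtain ⟨t, ht, rfl⟩ := hx
      have : ((t + T : ℝ) : AddCircle T) ∈ ((↑) : ℝ → AddCircle T) '' Ioo (c + T) (d + T) :=
        ⟨t + T, ⟨by linarith [ht.1], by linarith [ht.2]⟩, rfl⟩
      rw [AddCircle.coe_add_period] at this
      exact ⟨(hU.1 this).1, (hU.1 this).2.1⟩
    rcases h with h | h
    · exact hne.2 h
    · exact hne.1 h
  refine Subset.antisymm ?_ ((isPreconnected_coe_image_Ioo c d).subset_connectedComponentIn ha hsub)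
  refine IsPreconnected.subset_left_of_subset_union (isOpen_coe_image_Ioo c d)
    (isOpen_coe_image_Ioo d (c + T)) ?_ ?_ ⟨a, mem_connectedComponentIn (hsub ha), ha⟩
    isPreconnected_connectedComponentIn
  · exact disjoint_left.2 fun x hx hx' => ((hV x).1 hx').2.2 hx
  · intro x hx
    have h := connectedComponentIn_subset _ _ hx
    by_cases hxU : x ∈ ((↑) : ℝ → AddCircle T) '' Ioo c d
    · exact Or.inl hxU
    · exact Or.inr ((hV x).2 ⟨fun h' => h (Or.inl h'), fun h' => h (Or.inr h'), hxU⟩)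

lemma connectedComponentIn_eq_coe_image_Ioo_add {c d : ℝ} (hcd : c < d) (hd : d < c + T)
    {a : AddCircle T} (ha : a ∈ ((↑) : ℝ → AddCircle T) '' Ioo d (c + T)) :
    connectedComponentIn ({(c : AddCircle T), (d : AddCircle T)}ᶜ) a
      = ((↑) : ℝ → AddCircle T) '' Ioo d (c + T) := by
  have h := connectedComponentIn_eq_coe_image_Ioo hd (by linarith : c + T < d + T) ha
  rwa [AddCircle.coe_add_period, pair_comm] at h

/-- Being separated by `{c, d}` on the circle, read off in a fundamental domain `[s, s + T)`. -/
lemma mem_connectedComponentIn_pair_iff {s : ℝ} {a b c d : AddCircle T}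
    (hcd : circleLift s c < circleLift s d) (hac : a ≠ c) (had : a ≠ d) :
    b ∈ connectedComponentIn ({c, d}ᶜ) a ↔ b ≠ c ∧ b ≠ d ∧
      (circleLift s a ∈ Ioo (circleLift s c) (circleLift s d) ↔
        circleLift s b ∈ Ioo (circleLift s c) (circleLift s d)) := by
  have hc := circleLift_mem s c
  have hd := circleLift_mem s d
  have hd' : circleLift s d < circleLift s c + T := by linarith [hc.1, hd.2]
  have hV := mem_coe_image_Ioo_add_iff (T := T) hcd hd'
  have hU (x : AddCircle T) := mem_coe_image_iff (s := s)
    (S := Ioo (circleLift s c) (circleLift s d))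
    (fun t ht => ⟨(hc.1.trans_lt ht.1).le, ht.2.trans hd.2⟩) x
  have key₁ := connectedComponentIn_eq_coe_image_Ioo (T := T) (a := a) hcd hd'
  have key₂ := connectedComponentIn_eq_coe_image_Ioo_add (T := T) (a := a) hcd hd'
  simp only [coe_circleLift] at hV key₁ key₂
  rw [← hU, ← hU]
  by_cases ha : a ∈ ((↑) : ℝ → AddCircle T) '' Ioo (circleLift s c) (circleLift s d)
  · rw [key₁ ha]
    simp only [ha, true_iff]
    refine ⟨fun h => ⟨?_, ?_, h⟩, fun h => h.2.2⟩
    · rintro rfl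
      exact lt_irrefl _ ((hU _).1 h).1
    · rintro rfl
      exact lt_irrefl _ ((hU _).1 h).2
  · rw [key₂ ((hV a).2 ⟨hac, had, ha⟩), hV]
    simp only [ha, false_iff]

lemma isOpen_connectedComponentIn_pair {c d : AddCircle T} (hcd : c ≠ d) (a : AddCircle T) :
    IsOpen (connectedComponentIn ({c, d}ᶜ) a) := by
  by_cases ha : a ∈ ({c, d}ᶜ : Set (AddCircle T))
  · wlog h : circleLift 0 c < circleLift 0 d generalizing c d
    · rw [pair_comm] at ha ⊢
      exact this hcd.symm ha
        (lt_of_le_of_ne (not_lt.1 h) fun h' => hcd (circleLift_injective 0 h'.symm))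
    have hc := circleLift_mem 0 c
    have hd := circleLift_mem 0 d
    have hd' : circleLift 0 d < circleLift 0 c + T := by linarith [hc.1, hd.2]
    have key₁ := connectedComponentIn_eq_coe_image_Ioo (T := T) (a := a) h hd'
    have key₂ := connectedComponentIn_eq_coe_image_Ioo_add (T := T) (a := a) h hd'
    have hV := mem_coe_image_Ioo_add_iff (T := T) h hd' a
    simp only [coe_circleLift] at hV key₁ key₂
    by_cases haU : a ∈ ((↑) : ℝ → AddCircle T) '' Ioo (circleLift 0 c) (circleLift 0 d)
    · rw [key₁ haU]
      exact isOpen_coe_image_Ioo _ _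
    · rw [key₂ (hV.2 ⟨fun h => ha (Or.inl h), fun h => ha (Or.inr h), haU⟩)]
      exact isOpen_coe_image_Ioo _ _
  · rw [connectedComponentIn_eq_empty ha]
    exact isOpen_empty

/-- If `y` and `z` are not separated by the endpoints of the projection to the circle of the
interval `[B, A]`, then a suitable translation carries the lifts of `y` in `[B, A]` to the lifts
of `z` in `[B, A]`. -/
lemma exists_translation_lifts {A B : ℝ} {y z : AddCircle T}
    (hyB : y ≠ B) (hyA : y ≠ A) (hzB : z ≠ B)
    (h : (B : AddCircle T) ≠ A →
      z ∈ connectedComponentIn ({(B : AddCircle T), (A : AddCircle T)}ᶜ) y) :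
    ∃ v : ℝ, ∀ t ∈ Icc B A, (t : AddCircle T) = y →
      t + v ∈ Icc B A ∧ ((t + v : ℝ) : AddCircle T) = z := by
  have hT' := hT.out
  have hB : circleLift B (B : AddCircle T) = B := circleLift_coe ⟨le_rfl, by linarith⟩
  have hA := circleLift_mem B (A : AddCircle T)
  have hlt (x : AddCircle T) (hx : x ≠ B) : B < circleLift B x :=
    lt_of_le_of_ne (circleLift_mem B x).1 fun h' =>
      hx (circleLift_injective B (by rw [hB, ← h']))
  have hy := hlt y hyB
  have hz := hlt z hzB
  have hy' := (circleLift_mem B y).2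
  have hz' := (circleLift_mem B z).2
  have hyz : circleLift B y ≤ circleLift B (A : AddCircle T) →
      circleLift B z ≤ circleLift B (A : AddCircle T) := by
    intro hle
    by_cases hBA : (B : AddCircle T) = A
    · rw [← hBA, hB] at hle
      linarith
    · have hs := (mem_connectedComponentIn_pair_iff (s := B)
        (by rw [hB]; exact hlt _ (Ne.symm hBA)) hyB hyA).1 (h hBA)
      rw [hB] at hs
      exact (hs.2.2.1 ⟨hy, lt_of_le_of_ne hle fun h' => hyA (circleLift_injective B h')⟩).2.le
  refine ⟨circleLift B z - circleLift B y, fun t ht hty => ?_⟩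
  obtain ⟨k, hk⟩ : ∃ k : ℤ, t = circleLift B y + k * T := by
    have h0 : ((t - circleLift B y : ℝ) : AddCircle T) = 0 := by
      rw [AddCircle.coe_sub, hty, coe_circleLift, sub_self]
    obtain ⟨k, hk⟩ := (AddCircle.coe_eq_zero_iff T).1 h0
    exact ⟨k, by rw [zsmul_eq_mul] at hk; linarith⟩
  obtain ⟨j, hj⟩ : ∃ j : ℤ, A = circleLift B (A : AddCircle T) + j * T := by
    have h0 : ((A - circleLift B (A : AddCircle T) : ℝ) : AddCircle T) = 0 := by
      rw [AddCircle.coe_sub, coe_circleLift, sub_self]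
    obtain ⟨k, hk⟩ := (AddCircle.coe_eq_zero_iff T).1 h0
    exact ⟨k, by rw [zsmul_eq_mul] at hk; linarith⟩
  have htv : t + (circleLift B z - circleLift B y) = circleLift B z + k * T := by
    rw [hk]; ring
  refine ⟨?_, ?_⟩
  · rw [htv]
    have hk0 : 0 ≤ k := by
      by_contra! hneg
      have : (k : ℝ) ≤ -1 := by exact_mod_cast (by omega : k ≤ -1)
      nlinarith [ht.1]
    have hk0' : (0 : ℝ) ≤ k := by exact_mod_cast hk0
    refine ⟨by nlinarith, ?_⟩
    rcases lt_trichotomy k j with hkj | hkj | hkj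
    · have : (k : ℝ) + 1 ≤ j := by exact_mod_cast hkj
      rw [hj]
      nlinarith [hA.1]
    · subst hkj
      have := hyz (by linarith [ht.2])
      linarith
    · have : (j : ℝ) + 1 ≤ k := by exact_mod_cast hkj
      nlinarith [hA.2, ht.2]
  · rw [AddCircle.coe_add, AddCircle.coe_sub, hty, coe_circleLift, coe_circleLift]
    abel

end Arcs

section Fibers

variable {T : ℝ} [hT : Fact (0 < T)]

lemma ncard_setOf_nsmul_add_eq {d : ℕ} (hd : 0 < d) (P : AddCircle T → Prop)
    [DecidablePred P] (e x : AddCircle T) :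
    {u | P u ∧ d • u + e = d • x + e}.ncard =
      ∑ k ∈ Finset.range d, if P (x + k • ((T / d : ℝ) : AddCircle T)) then 1 else 0 := by
  rw [← Finset.card_filter]
  have hinj : InjOn (fun k : ℕ => x + k • ((T / d : ℝ) : AddCircle T))
      ((Finset.range d).filter fun k => P (x + k • ((T / d : ℝ) : AddCircle T))) := by
    intro i hi j hj hij
    simp only [Finset.coe_filter, Finset.mem_range, mem_ofPred_eq] at hi hj
    refine nsmul_injOn_Iio_addOrderOf (x := ((T / d : ℝ) : AddCircle T)) ?_ ?_
      (add_left_cancel hij)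
    · rw [AddCircle.addOrderOf_period_div hd]; exact hi.1
    · rw [AddCircle.addOrderOf_period_div hd]; exact hj.1
  rw [← ncard_coe_finset, ← hinj.ncard_image]
  congr 1
  ext u
  simp only [mem_ofPred_eq, add_left_inj, mem_image, Finset.coe_filter, Finset.mem_range]
  constructor
  · rintro ⟨hu, h⟩
    have h0 : d • (u - x) = 0 := by rw [smul_sub, h, sub_self]
    obtain ⟨k, hk, hk'⟩ := (AddCircle.nsmul_eq_zero_iff hd).1 h0
    rw [AddCircle.natCast_div_mul_eq_nsmul] at hk'
    have : x + k • ((T / d : ℝ) : AddCircle T) = u := by rw [hk']; abel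
    exact ⟨k, ⟨hk, by rwa [this]⟩, this⟩
  · rintro ⟨k, ⟨hk, hP⟩, rfl⟩
    refine ⟨hP, ?_⟩
    rw [smul_add, smul_comm]
    have : d • ((T / d : ℝ) : AddCircle T) = 0 := by
      have h := addOrderOf_nsmul_eq_zero ((T / d : ℝ) : AddCircle T)
      rwa [AddCircle.addOrderOf_period_div hd] at h
    rw [this, smul_zero, add_zero]

lemma ncard_fiber_nsmul_add {d : ℕ} (hd : 0 < d) (e y : AddCircle T) :
    {u | d • u + e = y}.ncard = d := by
  obtain ⟨x, rfl⟩ := exists_nsmul_add_eq hd e y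
  simpa using ncard_setOf_nsmul_add_eq hd (fun _ => True) e x

lemma finite_fiber_nsmul_add {d : ℕ} (hd : 0 < d) (e y : AddCircle T) :
    {u | d • u + e = y}.Finite :=
  finite_of_ncard_pos (by rw [ncard_fiber_nsmul_add hd]; exact hd)

lemma measurePreserving_nsmul_add {d : ℕ} (hd : 0 < d) (e : AddCircle T) :
    MeasurePreserving (fun u : AddCircle T => d • u + e) := by
  rcases (Nat.succ_le_of_lt hd).eq_or_lt with h | h
  · rw [← h]
    simpa using measurePreserving_add_right (volume : Measure (AddCircle T)) e
  · exact (AddCircle.ergodic_nsmul_add e h).toMeasurePreserving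

lemma nullSingletonClass_addCircle : NullSingletonClass (volume : Measure (AddCircle T)) := by
  have : Nontrivial (AddCircle T) := by
    refine ⟨⟨((T / 2 : ℝ) : AddCircle T), 0, fun h => ?_⟩⟩
    have h1 := AddCircle.addOrderOf_period_div (p := T) (n := 2) two_pos
    rw [Nat.cast_ofNat, h] at h1
    simp at h1
  infer_instance

/-- The measure of a set counted through the fibers of `u ↦ d • u + e`. -/
lemma lintegral_ncard_fiber {d : ℕ} (hd : 0 < d) (e : AddCircle T) {S : Set (AddCircle T)}
    (hS : MeasurableSet S) :
    ∫⁻ x, (({u | u ∈ S ∧ d • u + e = d • x + e}.ncard : ℕ) : ENNReal) = d * volume S := by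
  classical
  simp_rw [ncard_setOf_nsmul_add_eq hd (fun u => u ∈ S) e]
  push_cast
  have hk (k : ℕ) : MeasurableSet ((fun x => x + k • ((T / d : ℝ) : AddCircle T)) ⁻¹' S) :=
    measurable_add_const _ hS
  have heq (k : ℕ) : (fun x : AddCircle T => if x + k • ((T / d : ℝ) : AddCircle T) ∈ S
      then (1 : ENNReal) else 0) =
      ((fun x => x + k • ((T / d : ℝ) : AddCircle T)) ⁻¹' S).indicator 1 := by
    ext x
    simp [indicator_apply]
  rw [lintegral_finsetSum]
  · simp_rw [heq]
    simp_rw [lintegral_indicator_one (hk _)]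
    simp [measure_preimage_add_right]
  · intro k _
    rw [heq]
    exact measurable_one.indicator (hk k)

end Fibers

section Counting

/-- If two finite sets meet every member of a finite family in equally many points, and any two
intersecting members lie in a common member, then they meet its union in equally many points. -/
lemma card_inter_biUnion_eq {α : Type*} {F : Set (Set α)} (hF : F.Finite)
    (hdir : ∀ I ∈ F, ∀ J ∈ F, (I ∩ J).Nonempty → ∃ K ∈ F, I ⊆ K ∧ J ⊆ K)
    {Y Z : Set α} (hY : Y.Finite) (hZ : Z.Finite)
    (hYZ : ∀ I ∈ F, (Y ∩ I).ncard = (Z ∩ I).ncard) :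
    (Y ∩ ⋃₀ F).ncard = (Z ∩ ⋃₀ F).ncard := by
  classical
  have hMF : {I | Maximal (· ∈ F) I} ⊆ F := fun I hI => hI.1
  have hM := hF.subset hMF
  have hU : ⋃₀ F = ⋃ I ∈ {I | Maximal (· ∈ F) I}, I := by
    ext x
    simp only [mem_sUnion, mem_iUnion, exists_prop]
    constructor
    · rintro ⟨I, hI, hx⟩
      obtain ⟨J, hIJ, hJ⟩ := hF.exists_le_maximal hI
      exact ⟨J, hJ, hIJ hx⟩
    · rintro ⟨I, hI, hx⟩
      exact ⟨I, hI.1, hx⟩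
  have hdisj : ({I | Maximal (· ∈ F) I}).PairwiseDisjoint id := by
    intro I hI J hJ hne
    by_contra hnd
    obtain ⟨K, hK, hIK, hJK⟩ := hdir I hI.1 J hJ.1 (not_disjoint_iff_nonempty_inter.1 hnd)
    exact hne ((hI.eq_of_le hK hIK).trans (hJ.eq_of_le hK hJK).symm)
  have key (W : Set α) (hW : W.Finite) :
      (W ∩ ⋃₀ F).ncard = ∑ I ∈ hM.toFinset, (W ∩ I).ncard := by
    have := ncard_eq_toFinset_card _ (hW.inter_of_left (⋃₀ F))
    have hsum : (hW.inter_of_left (⋃₀ F)).toFinset =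
        hM.toFinset.biUnion fun I => (hW.inter_of_left I).toFinset := by
      ext x
      simp only [Finite.mem_toFinset, mem_inter_iff, hU, mem_iUnion, Finset.mem_biUnion]
      exact ⟨fun ⟨hx, I, hI, hxI⟩ => ⟨I, hI, hx, hxI⟩, fun ⟨I, hI, hx, hxI⟩ => ⟨hx, I, hI, hxI⟩⟩
    rw [this, hsum, Finset.card_biUnion]
    · exact Finset.sum_congr rfl fun I _ => (ncard_eq_toFinset_card _ _).symm
    · intro I hI J hJ hne
      rw [Function.onFun, Finite.disjoint_toFinset]
      exact (hdisj (hM.mem_toFinset.1 hI) (hM.mem_toFinset.1 hJ) hne).mono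
        inter_subset_right inter_subset_right
  rw [key Y hY, key Z hZ]
  exact Finset.sum_congr rfl fun I hI => hYZ I (hMF (hM.mem_toFinset.1 hI))

end Counting

section Laminations

/-- The points of the circle lying in a nontrivial class. -/
def FiniteLamination.support (L : FiniteLamination) : Set Circle2pi :=
  {x | ∃ y, L.rel x y ∧ y ≠ x}

variable {L : FiniteLamination} {G : Set Circle2pi}

lemma FiniteLamination.finite_support (L : FiniteLamination) : L.support.Finite :=
  L.nontrivial_finite

lemma FiniteLamination.mem_support_left {c d : Circle2pi} (h : L.rel c d) (hcd : c ≠ d) :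
    c ∈ L.support := ⟨d, h, hcd.symm⟩

lemma FiniteLamination.mem_support_right {c d : Circle2pi} (h : L.rel c d) (hcd : c ≠ d) :
    d ∈ L.support := ⟨c, L.iseqv.symm h, hcd⟩

lemma UnlinkedSet.disjoint_support (hG : UnlinkedSet L G) {g : Circle2pi} (hg : g ∈ G) :
    g ∉ L.support := by
  rintro ⟨d, h, hd⟩
  exact connectedComponentIn_subset _ _ (hG g hg g hg g d h hd.symm) (Or.inl rfl)

lemma IsGapOf.mem_iff (hG : IsGapOf L G) {g : Circle2pi} (hg : g ∈ G) (x : Circle2pi) :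
    x ∈ G ↔ ∀ c d : Circle2pi, L.rel c d → c ≠ d →
      x ∈ connectedComponentIn ({c, d}ᶜ : Set Circle2pi) g := by
  obtain ⟨-, -, hU, hmax⟩ := hG
  suffices h : G = {x | ∀ c d : Circle2pi, L.rel c d → c ≠ d →
      x ∈ connectedComponentIn ({c, d}ᶜ : Set Circle2pi) g} by
    exact Set.ext_iff.1 h x
  refine hmax _ ?_ ?_ fun x hx c d h hcd => hU g hg x hx c d h hcd
  · have hfin : {p : Circle2pi × Circle2pi | L.rel p.1 p.2 ∧ p.1 ≠ p.2}.Finite :=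
      (L.finite_support.prod L.finite_support).subset fun p hp =>
        ⟨L.mem_support_left hp.1 hp.2, L.mem_support_right hp.1 hp.2⟩
    have := hfin.isOpen_biInter fun p hp => isOpen_connectedComponentIn_pair hp.2 g
    convert this using 1
    ext x
    simp
  · intro a ha b hb c d h hcd
    rw [← connectedComponentIn_eq (ha c d h hcd)]
    exact hb c d h hcd

lemma IsGapOf.closure_subset (hG : IsGapOf L G) : closure G ⊆ G ∪ L.support := by
  intro p hp
  by_contra hcon
  rw [mem_union, not_or] at hcon
  obtain ⟨g, hg⟩ := hG.2.1
  refine hcon.1 ((hG.mem_iff hg p).2 fun c d h hcd => ?_)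
  have hpc : p ∈ ({c, d}ᶜ : Set Circle2pi) := by
    rintro (rfl | rfl)
    · exact hcon.2 (L.mem_support_left h hcd)
    · exact hcon.2 (L.mem_support_right h hcd)
  obtain ⟨q, hqp, hqG⟩ := mem_closure_iff.1 hp _ (isOpen_connectedComponentIn_pair hcd p)
    (mem_connectedComponentIn hpc)
  rw [connectedComponentIn_eq ((hG.mem_iff hg q).1 hqG c d h hcd), ← connectedComponentIn_eq hqp]
  exact mem_connectedComponentIn hpc

/-- The arcs subtended by the leaves of `L`, in the fundamental domain `[s, s + 2π)`. -/
def FiniteLamination.leafArcs (L : FiniteLamination) (s : ℝ) : Set (Set Circle2pi) :=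
  {I | ∃ c d, L.rel c d ∧ circleLift s c < circleLift s d ∧
    I = circleLift s ⁻¹' Icc (circleLift s c) (circleLift s d)}

lemma FiniteLamination.finite_leafArcs (L : FiniteLamination) (s : ℝ) : (L.leafArcs s).Finite := by
  refine ((L.finite_support.prod L.finite_support).image fun p =>
    circleLift s ⁻¹' Icc (circleLift s p.1) (circleLift s p.2)).subset ?_
  rintro I ⟨c, d, h, hlt, rfl⟩
  have hcd : c ≠ d := fun h => hlt.ne (congrArg _ h)
  exact ⟨(c, d), ⟨L.mem_support_left h hcd, L.mem_support_right h hcd⟩, rfl⟩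

lemma FiniteLamination.leafArcs_directed (L : FiniteLamination) (s : ℝ) :
    ∀ I ∈ L.leafArcs s, ∀ J ∈ L.leafArcs s, (I ∩ J).Nonempty →
      ∃ K ∈ L.leafArcs s, I ⊆ K ∧ J ⊆ K := by
  rintro I ⟨c, d, h, hlt, rfl⟩ J ⟨c', d', h', hlt', rfl⟩ ⟨x, hx, hx'⟩
  have hcd : c ≠ d := fun h => hlt.ne (congrArg _ h)
  have hcd' : c' ≠ d' := fun h => hlt'.ne (congrArg _ h)
  by_cases hr : L.rel c' c
  · obtain ⟨e, he, hec, hec'⟩ : ∃ e, L.rel c e ∧ circleLift s e ≤ circleLift s c ∧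
        circleLift s e ≤ circleLift s c' := by
      rcases le_total (circleLift s c) (circleLift s c') with hle | hle
      · exact ⟨c, L.iseqv.refl c, le_rfl, hle⟩
      · exact ⟨c', L.iseqv.symm hr, hle, le_rfl⟩
    obtain ⟨f, hf, hfd, hfd'⟩ : ∃ f, L.rel c f ∧ circleLift s d ≤ circleLift s f ∧
        circleLift s d' ≤ circleLift s f := by
      rcases le_total (circleLift s d) (circleLift s d') with hle | hle
      · exact ⟨d', L.iseqv.trans (L.iseqv.symm hr) h', hle, le_rfl⟩
      · exact ⟨d, h, le_rfl, hle⟩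
    exact ⟨_, ⟨e, f, L.iseqv.trans (L.iseqv.symm he) hf, by linarith, rfl⟩,
      preimage_mono (Icc_subset_Icc hec hfd), preimage_mono (Icc_subset_Icc hec' hfd')⟩
  · have hc'c : c' ≠ c := by rintro rfl; exact hr (L.iseqv.refl _)
    have hc'd : c' ≠ d := by rintro rfl; exact hr (L.iseqv.symm h)
    have key := ((mem_connectedComponentIn_pair_iff hlt hc'c hc'd).1
      (L.unlinked c' d' c d h' h hr hcd' hcd)).2.2
    have h1 : circleLift s c' ≠ circleLift s c := fun h => hc'c (circleLift_injective s h)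
    have h2 : circleLift s c' ≠ circleLift s d := fun h => hc'd (circleLift_injective s h)
    have h3 : circleLift s c ≤ circleLift s d' := hx.1.trans hx'.2
    have h4 : circleLift s c' ≤ circleLift s d := hx'.1.trans hx.2
    by_cases hin : circleLift s c' ∈ Ioo (circleLift s c) (circleLift s d)
    · exact ⟨_, ⟨c, d, h, hlt, rfl⟩, subset_rfl,
        preimage_mono (Icc_subset_Icc hin.1.le (key.1 hin).2.le)⟩
    · have hc : circleLift s c' < circleLift s c := by
        by_contra! hge
        exact hin ⟨lt_of_le_of_ne hge h1.symm, lt_of_le_of_ne h4 h2⟩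
      have hd : circleLift s d ≤ circleLift s d' := by
        by_contra! hlt''
        have hne : circleLift s c ≠ circleLift s d' := by
          intro he
          obtain rfl := circleLift_injective s he
          exact hr h'
        exact hin (key.2 ⟨lt_of_le_of_ne h3 hne, hlt''⟩)
      exact ⟨_, ⟨c', d', h', hlt', rfl⟩, preimage_mono (Icc_subset_Icc hc.le hd), subset_rfl⟩

lemma IsGapOf.compl_eq_sUnion_leafArcs (hG : IsGapOf L G) {s : ℝ} (hs : (s : Circle2pi) ∈ G) :
    Gᶜ = ⋃₀ L.leafArcs s := by
  have hs0 : circleLift s (s : Circle2pi) = s :=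
    circleLift_coe ⟨le_rfl, by linarith [Real.pi_pos]⟩
  have hsupp := hG.2.2.1.disjoint_support hs
  have key {c d : Circle2pi} (h : L.rel c d) (hlt : circleLift s c < circleLift s d)
      (x : Circle2pi) : x ∈ connectedComponentIn ({c, d}ᶜ : Set Circle2pi) s ↔
        x ∉ circleLift s ⁻¹' Icc (circleLift s c) (circleLift s d) := by
    have hcd : c ≠ d := fun h => hlt.ne (congrArg _ h)
    rw [mem_connectedComponentIn_pair_iff hlt
      (by rintro rfl; exact hsupp (L.mem_support_left h hcd))
      (by rintro rfl; exact hsupp (L.mem_support_right h hcd)), hs0]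
    have : s ∉ Ioo (circleLift s c) (circleLift s d) :=
      fun h => (circleLift_mem s c).1.not_gt h.1
    simp only [this, false_iff, mem_preimage]
    rw [← (circleLift_injective s).ne_iff, ← (circleLift_injective s).ne_iff (x := x) (y := d)]
    constructor
    · rintro ⟨h1, h2, h3⟩ h4
      exact h3 ⟨lt_of_le_of_ne h4.1 h1.symm, lt_of_le_of_ne h4.2 h2⟩
    · intro h
      refine ⟨fun he => h ?_, fun he => h ?_, fun h' => h (Ioo_subset_Icc_self h')⟩
      · rw [he]; exact left_mem_Icc.2 hlt.le
      · rw [he]; exact right_mem_Icc.2 hlt.le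
  ext x
  rw [mem_compl_iff, hG.mem_iff hs x, mem_sUnion]
  constructor
  · intro h
    push Not at h
    obtain ⟨c, d, h, hcd, hx⟩ := h
    wlog hlt : circleLift s c < circleLift s d generalizing c d
    · exact this d c (L.iseqv.symm h) hcd.symm (by rwa [pair_comm])
        (lt_of_le_of_ne (not_lt.1 hlt) fun h' => hcd (circleLift_injective s h'.symm))
    rw [key h hlt, not_not] at hx
    exact ⟨_, ⟨c, d, h, hlt, rfl⟩, hx⟩
  · rintro ⟨I, ⟨c, d, h, hlt, rfl⟩, hx⟩ hall
    exact (key h hlt x).1 (hall c d h fun h => hlt.ne (congrArg _ h)) hx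

end Laminations

section Covers

variable {L₁ L₂ : FiniteLamination} {G G' : Set Circle2pi}

lemma LamBranchedCover.map_rel (δ : LamBranchedCover L₁ L₂) {c d : Circle2pi}
    (h : L₁.rel c d) : L₂.rel (δ.map c) (δ.map d) := by
  have h' : δ.map d ∈ L₂.cls (δ.map c) := by
    rw [LamBranchedCover.map, LamBranchedCover.map, ← δ.maps_cls c]
    exact ⟨d, h, rfl⟩
  exact h'

lemma LamBranchedCover.ncard_fiber_inter_leafArc_le (δ : LamBranchedCover L₁ L₂)
    (hG' : UnlinkedSet L₂ G') {y z : Circle2pi} (hy : y ∈ G') (hz : z ∈ G')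
    (hy' : y ∉ δ.map '' L₁.support) (hz' : z ∉ δ.map '' L₁.support) {s : ℝ}
    {I : Set Circle2pi} (hI : I ∈ L₁.leafArcs s) :
    ({x | δ.map x = y} ∩ I).ncard ≤ ({x | δ.map x = z} ∩ I).ncard := by
  obtain ⟨c, d, h, hlt, rfl⟩ := hI
  have hcd : c ≠ d := fun h => hlt.ne (congrArg _ h)
  have hd0 : (0 : ℝ) < δ.deg := by exact_mod_cast δ.deg_pos
  obtain ⟨e, he⟩ := QuotientAddGroup.mk_surjective δ.shift
  have hmap (t : ℝ) : δ.map (t : Circle2pi) = ((δ.deg * t + e : ℝ) : Circle2pi) := by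
    rw [LamBranchedCover.map, ← he, AddCircle.coe_add, ← nsmul_eq_mul, AddCircle.coe_nsmul]
  have hmapL (x : Circle2pi) :
      δ.map x = ((δ.deg * circleLift s x + e : ℝ) : Circle2pi) := by
    rw [← hmap, coe_circleLift]
  have hne {w p : Circle2pi} (hw : w ∉ δ.map '' L₁.support) (hp : p ∈ L₁.support) :
      w ≠ ((δ.deg * circleLift s p + e : ℝ) : Circle2pi) := by
    rintro rfl
    exact hw ⟨p, hp, hmapL p⟩
  have hc := L₁.mem_support_left h hcd
  have hd := L₁.mem_support_right h hcd
  obtain ⟨v, hv⟩ := exists_translation_lifts (hne hy' hc) (hne hy' hd) (hne hz' hc) fun hne => by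
    rw [← hmapL, ← hmapL] at hne ⊢
    exact hG' y hy z hz _ _ (δ.map_rel h) hne
  refine ncard_le_ncard_of_injOn (fun x => x + ((v / δ.deg : ℝ) : Circle2pi)) ?_
    (fun _ _ _ _ h => add_right_cancel h) ((finite_fiber_nsmul_add δ.deg_pos δ.shift z).inter_of_left _)
  rintro x ⟨hx, hxI⟩
  have hx' : ((δ.deg * circleLift s x + e : ℝ) : Circle2pi) = y := by rw [← hmapL]; exact hx
  obtain ⟨h1, h2⟩ := hv (δ.deg * circleLift s x + e)
    ⟨by gcongr; exact hxI.1, by gcongr; exact hxI.2⟩ hx'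
  have hvd : δ.deg * circleLift s x + e + v = δ.deg * (circleLift s x + v / δ.deg) + e := by
    field_simp
    ring
  rw [hvd] at h1 h2
  have hxv : x + ((v / δ.deg : ℝ) : Circle2pi) =
      ((circleLift s x + v / δ.deg : ℝ) : Circle2pi) := by
    rw [AddCircle.coe_add, coe_circleLift]
  have hmem : circleLift s x + v / δ.deg ∈ Icc (circleLift s c) (circleLift s d) :=
    ⟨le_of_mul_le_mul_left (by linarith [h1.1]) hd0, le_of_mul_le_mul_left (by linarith [h1.2]) hd0⟩
  refine ⟨?_, ?_⟩
  · show δ.map _ = z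
    rw [hxv, hmap, h2]
  · change circleLift s (x + ((v / δ.deg : ℝ) : Circle2pi)) ∈
      Icc (circleLift s c) (circleLift s d)
    rwa [hxv, circleLift_coe
      ⟨(circleLift_mem s c).1.trans hmem.1, hmem.2.trans_lt (circleLift_mem s d).2⟩]

/-- Generic points of an unlinked set of `L₂` have equally many preimages in a gap of `L₁`. -/
lemma LamBranchedCover.ncard_fiber_inter_gap_eq (δ : LamBranchedCover L₁ L₂)
    (hG : IsGapOf L₁ G) (hG' : UnlinkedSet L₂ G') {y z : Circle2pi} (hy : y ∈ G') (hz : z ∈ G')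
    (hy' : y ∉ δ.map '' L₁.support) (hz' : z ∉ δ.map '' L₁.support) :
    {x ∈ G | δ.map x = y}.ncard = {x ∈ G | δ.map x = z}.ncard := by
  obtain ⟨g, hg⟩ := hG.2.1
  obtain ⟨s, rfl⟩ := QuotientAddGroup.mk_surjective g
  have hfin (w : Circle2pi) : {x | δ.map x = w}.Finite :=
    finite_fiber_nsmul_add δ.deg_pos δ.shift w
  have hcard (w : Circle2pi) : {x | δ.map x = w}.ncard = δ.deg :=
    ncard_fiber_nsmul_add δ.deg_pos δ.shift w
  have hcount := card_inter_biUnion_eq (L₁.finite_leafArcs s) (L₁.leafArcs_directed s)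
    (hfin y) (hfin z) fun I hI => le_antisymm
      (δ.ncard_fiber_inter_leafArc_le hG' hy hz hy' hz' hI)
      (δ.ncard_fiber_inter_leafArc_le hG' hz hy hz' hy' hI)
  rw [← hG.compl_eq_sUnion_leafArcs hg, ← sdiff_eq, ← sdiff_eq] at hcount
  have hsplit (w : Circle2pi) : {x ∈ G | δ.map x = w}.ncard +
      ({x | δ.map x = w} \ G).ncard = δ.deg := by
    rw [← hcard w, ← ncard_inter_add_ncard_sdiff_eq_ncard _ G (hfin w), inter_comm]
    rfl
  have h1 := hsplit y
  have h2 := hsplit z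
  omega

lemma LamBranchedCover.deg_mul_volume_gap (δ : LamBranchedCover L₁ L₂)
    (hG : IsGapOf L₁ G) (hG' : IsGapOf L₂ G') (hmap : δ.map '' closure G ⊆ closure G')
    {F : Set Circle2pi} (hF : F.Finite) {m : ℕ}
    (hm : ∀ y ∈ G', y ∉ F → {x ∈ G | δ.map x = y}.ncard = m) :
    (δ.deg : ENNReal) * volume G = m * volume G' := by
  have hnull := nullSingletonClass_addCircle (T := 2 * Real.pi)
  have hpres : MeasurePreserving δ.map := measurePreserving_nsmul_add δ.deg_pos δ.shift
  have hzero : volume (δ.map ⁻¹' (F ∪ L₂.support)) = 0 :=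
    hpres.quasiMeasurePreserving.preimage_null ((hF.union L₂.finite_support).measure_zero _)
  have hmeas : ∫⁻ x, (({u ∈ G | δ.map u = δ.map x}.ncard : ℕ) : ENNReal) = δ.deg * volume G :=
    lintegral_ncard_fiber δ.deg_pos δ.shift hG.1.measurableSet
  rw [← hmeas, ← hpres.measure_preimage hG'.1.measurableSet.nullMeasurableSet,
    ← lintegral_indicator_const (hpres.measurable hG'.1.measurableSet)]
  refine lintegral_congr_ae ?_
  filter_upwards [measure_eq_zero_iff_ae_notMem.1 hzero] with x hx
  rw [mem_preimage, mem_union, not_or] at hx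
  by_cases hxG : δ.map x ∈ G'
  · rw [indicator_of_mem (mem_preimage.2 hxG), hm _ hxG hx.1]
  · rw [indicator_of_notMem (mt mem_preimage.1 hxG)]
    have hempty : {u ∈ G | δ.map u = δ.map x} = ∅ := by
      refine eq_empty_of_forall_notMem fun u hu => ?_
      have hu' : δ.map u ∈ closure G' := hmap (mem_image_of_mem _ (subset_closure hu.1))
      rw [hu.2] at hu'
      exact (hG'.closure_subset hu').elim hxG hx.2
    rw [hempty, ncard_empty, Nat.cast_zero]

end Covers

/-- If `δ : L₁ → L₂` is a branched covering of degree `d`, `G` is a gap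
of `L₁` and `G'` is the gap of `L₂` with `δ(cl G) = cl G'`, then the ratio
`d·μ(G)/μ(G')` is a positive integer `m`, and all but finitely many points of `G'` have
exactly `m` preimages in `G` under `δ` (so `m` is the topological degree of `δ|G`). -/
theorem lamination_cover_gap_degree
    (L₁ L₂ : FiniteLamination) (δ : LamBranchedCover L₁ L₂)
    (G G' : Set Circle2pi) (hG : IsGapOf L₁ G) (hG' : IsGapOf L₂ G')
    (hmap : δ.map '' closure G = closure G') :
    ∃ m : ℕ, 0 < m ∧
      (δ.deg : ℝ) * (volume G).toReal / (volume G').toReal = (m : ℝ) ∧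
      {y ∈ G' | ({x ∈ G | δ.map x = y}).ncard ≠ m}.Finite := by
  have hnull := nullSingletonClass_addCircle (T := 2 * Real.pi)
  have hF : (δ.map '' L₁.support).Finite := L₁.finite_support.image _
  have hGpos : 0 < volume G := hG.1.measure_pos _ hG.2.1
  have hG'pos : 0 < volume G' := hG'.1.measure_pos _ hG'.2.1
  obtain ⟨y₀, hy₀, hy₀F⟩ : ∃ y ∈ G', y ∉ δ.map '' L₁.support := by
    by_contra! hsub
    exact hG'pos.ne' ((hF.subset hsub).measure_zero _)
  obtain ⟨m, hm⟩ : ∃ m, m = {x ∈ G | δ.map x = y₀}.ncard := ⟨_, rfl⟩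
  have hconst : ∀ y ∈ G', y ∉ δ.map '' L₁.support → {x ∈ G | δ.map x = y}.ncard = m :=
    fun y hy hyF => hm ▸ δ.ncard_fiber_inter_gap_eq hG hG'.2.2.1 hy hy₀ hyF hy₀F
  have heq := δ.deg_mul_volume_gap hG hG' hmap.le hF hconst
  have heqR : (δ.deg : ℝ) * (volume G).toReal = m * (volume G').toReal := by
    simpa only [ENNReal.toReal_mul, ENNReal.toReal_natCast] using congrArg ENNReal.toReal heq
  have hdeg : δ.deg ≠ 0 := Nat.one_le_iff_ne_zero.1 δ.deg_pos
  refine ⟨m, Nat.pos_of_ne_zero fun h0 => ?_, ?_, hF.subset fun y hy => ?_⟩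
  · rw [h0, Nat.cast_zero, zero_mul, mul_eq_zero] at heq
    exact heq.elim (by exact_mod_cast hdeg) hGpos.ne'
  · rw [heqR, mul_div_cancel_right₀]
    exact (ENNReal.toReal_pos hG'pos.ne' (measure_ne_top _ _)).ne'
  · by_contra hyF
    exact hy.2 (hconst y hy.1 hyF)

end
end

section
/- Let δ: L₁ → L₂ be a branched covering of finite laminations on the circle C = ℝ/2πℤ of degree d. Then the total number of critical points of δ, counted with multiplicity, equals d − 1; that is, Σ_A (deg(δ,A) − 1) + Σ_G (deg(δ,G) − 1) = d − 1, where the first sum is over all equivalence classes A of L₁ (only finitely many terms are nonzero), the second sum is over all gaps G of L₁, deg(δ,A) = #A/#δ(A), and deg(δ,G) = d·μ(G)/μ(G') with G' the gap of L₂ satisfying δ(cl(G)) = cl(G'). -/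
open Set MeasureTheory Filter Topology

noncomputable section

/-! ### The angle coordinate and the arcs it cuts out -/

/-- The representative in `[0, 2π)` of a point of the circle. -/
def angle (x : Circle2pi) : ℝ := (AddCircle.equivIco (2 * Real.pi) 0 x : ℝ)

lemma angle_nonneg (x : Circle2pi) : 0 ≤ angle x := (AddCircle.equivIco (2 * Real.pi) 0 x).2.1

lemma angle_lt (x : Circle2pi) : angle x < 2 * Real.pi := by
  simpa [angle] using (AddCircle.equivIco (2 * Real.pi) 0 x).2.2

@[simp] lemma coe_angle (x : Circle2pi) : ((angle x : ℝ) : Circle2pi) = x :=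
  AddCircle.coe_equivIco

lemma angle_injective : Function.Injective angle := fun x y h => by
  rw [← coe_angle x, h, coe_angle]

lemma angle_coe {r : ℝ} (h₀ : 0 ≤ r) (h₁ : r < 2 * Real.pi) : angle (r : Circle2pi) = r :=
  AddCircle.equivIco_coe_of_mem ⟨h₀, by simpa using h₁⟩

lemma isOpen_coe_image {s : Set ℝ} (hs : IsOpen s) :
    IsOpen ((fun r : ℝ => (r : Circle2pi)) '' s) :=
  QuotientAddGroup.isOpenMap_coe s hs

lemma isPreconnected_coe_image_Ioo_s5 (a b : ℝ) :
    IsPreconnected ((fun r : ℝ => (r : Circle2pi)) '' Ioo a b) :=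
  isPreconnected_Ioo.image _ (AddCircle.continuous_mk' _).continuousOn

lemma coe_image_Ioo_angle (c d : Circle2pi) :
    (fun r : ℝ => (r : Circle2pi)) '' Ioo (angle c) (angle d) =
      {x | angle c < angle x ∧ angle x < angle d} := by
  ext x
  constructor
  · rintro ⟨r, hr, rfl⟩
    have h := angle_coe ((angle_nonneg c).trans hr.1.le) (hr.2.trans (angle_lt d))
    simpa [h] using hr
  · intro hx
    exact ⟨angle x, hx, coe_angle x⟩

lemma coe_image_Ioo_angle_add {c d : Circle2pi} (hcd : angle c < angle d) :
    (fun r : ℝ => (r : Circle2pi)) '' Ioo (angle d) (angle c + 2 * Real.pi) =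
      {x | angle x < angle c ∨ angle d < angle x} := by
  have hc := angle_lt c
  have hd := angle_lt d
  have hd₀ := angle_nonneg d
  have hc₀ := angle_nonneg c
  ext x
  constructor
  · rintro ⟨r, hr, rfl⟩
    rcases lt_or_ge r (2 * Real.pi) with h | h
    · right
      simpa [angle_coe (hd₀.trans hr.1.le) h] using hr.1
    · left
      have h' : ((r : ℝ) : Circle2pi) = ((r - 2 * Real.pi : ℝ) : Circle2pi) := by
        rw [← AddCircle.coe_add_period _ (r - 2 * Real.pi)]
        simp
      have h2 := hr.2
      simp only
      rw [h', angle_coe (by linarith) (by linarith)]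
      linarith
  · rintro (hx | hx)
    · refine ⟨angle x + 2 * Real.pi, ⟨?_, by linarith⟩, ?_⟩
      · linarith [angle_nonneg x]
      · simp only [AddCircle.coe_add_period, coe_angle]
    · exact ⟨angle x, ⟨hx, by linarith [angle_lt x]⟩, coe_angle x⟩

lemma connectedComponentIn_eq_of_union {X : Type*} [TopologicalSpace X] {F U V : Set X} {a : X}
    (hF : F = U ∪ V) (hU : IsOpen U) (hV : IsOpen V) (hUV : Disjoint U V)
    (hU' : IsPreconnected U) (ha : a ∈ U) : connectedComponentIn F a = U := by
  have haF : a ∈ F := hF ▸ Or.inl ha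
  apply subset_antisymm
  · exact isPreconnected_connectedComponentIn.subset_left_of_subset_union hU hV hUV
      ((connectedComponentIn_subset F a).trans hF.subset)
      ⟨a, mem_connectedComponentIn haF, ha⟩
  · exact hU'.subset_connectedComponentIn ha (hF ▸ subset_union_left)

/-- Two points lie in the same component of the complement of a pair exactly when they avoid the
pair and are not separated by it in the angle coordinate. -/
lemma mem_connectedComponentIn_pair_compl {c d : Circle2pi} (hcd : angle c < angle d)
    (a b : Circle2pi) :
    b ∈ connectedComponentIn ({c, d}ᶜ : Set Circle2pi) a ↔
      a ∉ ({c, d} : Set Circle2pi) ∧ b ∉ ({c, d} : Set Circle2pi) ∧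
        ((angle c < angle a ∧ angle a < angle d) ↔ (angle c < angle b ∧ angle b < angle d)) := by
  by_cases ha : a ∈ ({c, d} : Set Circle2pi)
  · have hempty : connectedComponentIn ({c, d}ᶜ : Set Circle2pi) a = ∅ :=
      connectedComponentIn_eq_empty fun h => h ha
    rw [hempty]
    simp [ha]
  have hmem : ∀ x : Circle2pi, x ∉ ({c, d} : Set Circle2pi) ↔
      angle x ≠ angle c ∧ angle x ≠ angle d := by
    intro x
    simp [angle_injective.eq_iff]
  set U := {x | angle c < angle x ∧ angle x < angle d} with hU
  set V := {x | angle x < angle c ∨ angle d < angle x} with hV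
  have hUo : IsOpen U := by
    rw [hU, ← coe_image_Ioo_angle]; exact isOpen_coe_image isOpen_Ioo
  have hVo : IsOpen V := by
    rw [hV, ← coe_image_Ioo_angle_add hcd]; exact isOpen_coe_image isOpen_Ioo
  have hUp : IsPreconnected U := by
    rw [hU, ← coe_image_Ioo_angle]; exact isPreconnected_coe_image_Ioo_s5 _ _
  have hVp : IsPreconnected V := by
    rw [hV, ← coe_image_Ioo_angle_add hcd]; exact isPreconnected_coe_image_Ioo_s5 _ _
  have hUV : Disjoint U V := by
    rw [Set.disjoint_left]
    rintro x ⟨h1, h2⟩ (h | h) <;> linarith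
  have hF : ({c, d}ᶜ : Set Circle2pi) = U ∪ V := by
    ext x
    rw [mem_compl_iff, hmem]
    simp only [hU, hV, mem_union, mem_ofPred_eq]
    grind
  have ha' : a ∈ U ∪ V := hF ▸ ha
  rcases ha' with ha' | ha'
  · rw [connectedComponentIn_eq_of_union hF hUo hVo hUV hUp ha', hmem, hmem]
    simp only [hU, mem_ofPred_eq] at ha' ⊢
    grind
  · rw [connectedComponentIn_eq_of_union (hF.trans (union_comm U V)) hVo hUo hUV.symm hVp ha',
      hmem, hmem]
    simp only [hV, mem_ofPred_eq] at ha' ⊢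
    grind

instance : LocallyPathConnectedSpace Circle2pi :=
  isQuotientMap_quotient_mk'.locallyPathConnectedSpace

namespace FiniteLamination

variable (L : FiniteLamination)

/-! ### Gaps are the classes of an equivalence relation -/

/-- The points lying in nontrivial classes. -/
def support_s5 : Set Circle2pi := {x | ∃ y, L.rel x y ∧ y ≠ x}

/-- No pair of distinct equivalent points separates `x` from `y`. -/
def GapRel (x y : Circle2pi) : Prop :=
  ∀ c d : Circle2pi, L.rel c d → c ≠ d → y ∈ connectedComponentIn ({c, d}ᶜ : Set Circle2pi) x

/-- The set of points not separated from `x`. -/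
def gapOf (x : Circle2pi) : Set Circle2pi := {y | L.GapRel x y}

variable {L}

lemma support_finite : L.support_s5.Finite := L.nontrivial_finite

lemma mem_support_left_s5 {c d : Circle2pi} (h : L.rel c d) (hcd : c ≠ d) : c ∈ L.support_s5 :=
  ⟨d, h, hcd.symm⟩

lemma mem_support_right_s5 {c d : Circle2pi} (h : L.rel c d) (hcd : c ≠ d) : d ∈ L.support_s5 :=
  ⟨c, L.iseqv.symm h, hcd⟩

lemma GapRel.symm {x y : Circle2pi} (h : L.GapRel x y) : L.GapRel y x := fun c d hr hcd => by
  have := h c d hr hcd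
  rw [← connectedComponentIn_eq this]
  exact mem_connectedComponentIn (connectedComponentIn_nonempty_iff.1 ⟨_, this⟩)

lemma GapRel.trans {x y z : Circle2pi} (h : L.GapRel x y) (h' : L.GapRel y z) : L.GapRel x z :=
  fun c d hr hcd => by
    rw [connectedComponentIn_eq (h c d hr hcd)]
    exact h' c d hr hcd

lemma gapRel_self_iff {x : Circle2pi} : L.GapRel x x ↔ x ∉ L.support_s5 := by
  constructor
  · rintro h ⟨y, hr, hyx⟩
    have := connectedComponentIn_subset _ _ (h x y hr hyx.symm)
    simp at this
  · intro hx c d hr hcd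
    apply mem_connectedComponentIn
    rintro (rfl | rfl)
    exacts [hx (mem_support_left_s5 hr hcd), hx (mem_support_right_s5 hr hcd)]

lemma gapOf_eq_gapOf_iff {x y : Circle2pi} (hy : y ∉ L.support_s5) :
    L.gapOf x = L.gapOf y ↔ L.GapRel x y := by
  constructor
  · intro h
    have : y ∈ L.gapOf y := gapRel_self_iff.2 hy
    rwa [← h] at this
  · intro h
    ext z
    exact ⟨fun hz => h.symm.trans hz, fun hz => h.trans hz⟩

lemma isOpen_gapOf (x : Circle2pi) : IsOpen (L.gapOf x) := by
  have hfin : {p : Circle2pi × Circle2pi | L.rel p.1 p.2 ∧ p.1 ≠ p.2}.Finite :=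
    (L.support_finite.prod L.support_finite).subset fun p hp =>
      ⟨mem_support_left_s5 hp.1 hp.2, mem_support_right_s5 hp.1 hp.2⟩
  have heq : L.gapOf x = ⋂ p ∈ {p : Circle2pi × Circle2pi | L.rel p.1 p.2 ∧ p.1 ≠ p.2},
      connectedComponentIn ({p.1, p.2}ᶜ : Set Circle2pi) x := by
    ext y
    simp [gapOf, GapRel]
  rw [heq]
  refine hfin.isOpen_biInter fun p _ => IsOpen.connectedComponentIn ?_
  exact (Set.toFinite _).isClosed.isOpen_compl

lemma isGapOf_iff {G : Set Circle2pi} : IsGapOf L G ↔ ∃ x ∉ L.support_s5, L.gapOf x = G := by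
  have hunl : ∀ x, UnlinkedSet L (L.gapOf x) := fun x a ha b hb => ha.symm.trans hb
  constructor
  · rintro ⟨-, ⟨x, hx⟩, hU, hmax⟩
    exact ⟨x, gapRel_self_iff.1 (hU x hx x hx),
      (hmax _ (isOpen_gapOf x) (hunl x) (hU x hx)).symm⟩
  · rintro ⟨x, hx, rfl⟩
    have hxx : x ∈ L.gapOf x := gapRel_self_iff.2 hx
    exact ⟨isOpen_gapOf x, ⟨x, hxx⟩, hunl x,
      fun G' _ hU hsub => hsub.antisymm (hU x (hsub hxx))⟩

lemma setOf_isGapOf_eq_image : {G | IsGapOf L G} = L.gapOf '' L.support_s5ᶜ := by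
  ext G
  exact isGapOf_iff

lemma gapRel_iff_angle {x y : Circle2pi} : L.GapRel x y ↔
    ∀ c d, L.rel c d → angle c < angle d →
      x ∉ ({c, d} : Set Circle2pi) ∧ y ∉ ({c, d} : Set Circle2pi) ∧
        ((angle c < angle x ∧ angle x < angle d) ↔ (angle c < angle y ∧ angle y < angle d)) := by
  constructor
  · intro h c d hr hcd
    exact (mem_connectedComponentIn_pair_compl hcd x y).1
      (h c d hr (fun h => hcd.ne (congrArg angle h)))
  · intro h c d hr hne
    rcases lt_or_gt_of_ne (angle_injective.ne hne) with hlt | hlt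
    · exact (mem_connectedComponentIn_pair_compl hlt x y).2 (h c d hr hlt)
    · rw [pair_comm]
      exact (mem_connectedComponentIn_pair_compl hlt x y).2 (h d c (L.iseqv.symm hr) hlt)

/-- Equivalent pairs that cross in the angle coordinate belong to the same class. -/
lemma rel_of_crossing {a b c d : Circle2pi} (hac : L.rel a c) (hbd : L.rel b d)
    (h₁ : angle a < angle b) (h₂ : angle b < angle c) (h₃ : angle c < angle d) : L.rel a b := by
  by_contra hab
  have hne : ∀ {x y : Circle2pi}, angle x < angle y → x ≠ y :=
    fun h h' => h.ne (congrArg angle h')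
  have := (mem_connectedComponentIn_pair_compl (h₂.trans h₃) a c).1
    (L.unlinked a c b d hac hbd hab (hne (h₁.trans h₂)) (hne (h₂.trans h₃)))
  exact absurd (this.2.2.2 ⟨h₂, h₃⟩).1 (not_lt.2 h₁.le)

/-! ### Counting gaps -/

variable (L) in
/-- The points that are not the last one, in the angle coordinate, of their class. -/
def nonlast : Set Circle2pi := {p | ∃ q, L.rel p q ∧ angle p < angle q}

variable (L) in
open Classical in
/-- The largest angle of a point before `x` whose class also has a point after `x`. -/
def level (x : Circle2pi) : WithBot ℝ :=
  ((L.support_finite.toFinset.filter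
    (fun p => angle p < angle x ∧ ∃ q, L.rel p q ∧ angle x < angle q)).image angle).max

lemma nonlast_subset_support : L.nonlast ⊆ L.support_s5 := fun _ ⟨_, hr, h⟩ =>
  mem_support_left_s5 hr (fun h' => h.ne (congrArg angle h'))

lemma angle_le_level {x p q : Circle2pi} (hr : L.rel p q) (hp : angle p < angle x)
    (hq : angle x < angle q) : (angle p : WithBot ℝ) ≤ L.level x := by
  classical
  refine Finset.le_max (Finset.mem_image_of_mem _ ?_)
  simp only [Finset.mem_filter, Set.Finite.mem_toFinset]
  exact ⟨nonlast_subset_support ⟨q, hr, hp.trans hq⟩, hp, q, hr, hq⟩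

lemma level_eq_bot_or (x : Circle2pi) : L.level x = ⊥ ∨
    ∃ p q, L.level x = angle p ∧ L.rel p q ∧ angle p < angle x ∧ angle x < angle q := by
  classical
  rcases h : L.level x with _ | r
  · exact Or.inl rfl
  · right
    have := Finset.mem_of_max h
    simp only [Finset.mem_image, Finset.mem_filter, Set.Finite.mem_toFinset] at this
    obtain ⟨p, ⟨-, hp, q, hr, hq⟩, rfl⟩ := this
    exact ⟨p, q, rfl, hr, hp, hq⟩

lemma level_le_of_gapRel {x y : Circle2pi} (h : L.GapRel x y) : L.level x ≤ L.level y := by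
  rcases level_eq_bot_or (L := L) x with hx | ⟨p, q, hx, hr, hp, hq⟩
  · simp [hx]
  · rw [hx]
    have := ((gapRel_iff_angle.1 h p q hr (hp.trans hq)).2.2).1 ⟨hp, hq⟩
    exact angle_le_level hr this.1 this.2

lemma separated_of_level_eq {x y : Circle2pi} (hy : y ∉ L.support_s5) (h : L.level x = L.level y)
    {c d : Circle2pi} (hr : L.rel c d) (hc : angle c < angle x) (hd : angle x < angle d) :
    angle c < angle y ∧ angle y < angle d := by
  have hcx := angle_le_level hr hc hd
  rcases level_eq_bot_or (L := L) x with hx | ⟨p, p', hx, hpr, hp, hp'⟩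
  · simp [hx] at hcx
  rcases level_eq_bot_or (L := L) y with hy' | ⟨q, q', hy', hqr, hq, hq'⟩
  · simp [hx, hy'] at h
  have hpq : p = q := angle_injective (by simpa [hx, hy'] using h)
  subst hpq
  have hcp : angle c ≤ angle p := by simpa [hx] using hcx
  refine ⟨hcp.trans_lt hq, ?_⟩
  by_contra! hdy
  have hdy : angle d < angle y := lt_of_le_of_ne hdy fun h' =>
    hy (angle_injective h' ▸ mem_support_right_s5 hr (fun h => (hc.trans hd).ne (congrArg angle h)))
  have hcp' : L.rel c p := by
    rcases hcp.eq_or_lt with h' | h'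
    · rw [angle_injective h']
      exact L.iseqv.refl p
    · exact rel_of_crossing hr hqr h' (hp.trans hd) (hdy.trans hq')
  have hdq : L.rel d q' := L.iseqv.trans (L.iseqv.symm hr) (L.iseqv.trans hcp' hqr)
  have := angle_le_level hdq hdy hq'
  rw [← h, hx, WithBot.coe_le_coe] at this
  linarith

lemma level_eq_iff {x y : Circle2pi} (hx : x ∉ L.support_s5) (hy : y ∉ L.support_s5) :
    L.level x = L.level y ↔ L.GapRel x y := by
  constructor
  · intro h
    rw [gapRel_iff_angle]
    intro c d hr hcd
    have hne : c ≠ d := fun h => hcd.ne (congrArg angle h)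
    have hnot : ∀ z ∉ L.support_s5, z ∉ ({c, d} : Set Circle2pi) := by
      rintro z hz (rfl | rfl)
      exacts [hz (mem_support_left_s5 hr hne), hz (mem_support_right_s5 hr hne)]
    exact ⟨hnot x hx, hnot y hy, fun h' => separated_of_level_eq hy h hr h'.1 h'.2,
      fun h' => separated_of_level_eq hx h.symm hr h'.1 h'.2⟩
  · exact fun h => (level_le_of_gapRel h).antisymm (level_le_of_gapRel h.symm)

lemma exists_angle_just_after {s : Set Circle2pi} (hs : s.Finite) (p : Circle2pi) :
    ∃ x, angle p < angle x ∧ ∀ q ∈ s, angle p < angle q → angle x < angle q := by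
  have h₁ : ∀ᶠ r in 𝓝[>] angle p, ∀ q ∈ s, angle p < angle q → r < angle q := by
    rw [Filter.eventually_all_finite hs]
    intro q _
    by_cases h : angle p < angle q
    · filter_upwards [Ioo_mem_nhdsGT h] with r hr _ using hr.2
    · exact Eventually.of_forall fun r h' => absurd h' h
  obtain ⟨r, hr, hr'⟩ := (h₁.and (Ioo_mem_nhdsGT (angle_lt p))).exists
  refine ⟨r, ?_⟩
  rw [angle_coe ((angle_nonneg p).trans hr'.1.le) hr'.2]
  exact ⟨hr'.1, hr⟩

lemma exists_angle_after_all {s : Set Circle2pi} (hs : s.Finite) :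
    ∃ x, ∀ q ∈ s, angle q < angle x := by
  have h₁ : ∀ᶠ r in 𝓝[<] (2 * Real.pi), ∀ q ∈ s, angle q < r := by
    rw [Filter.eventually_all_finite hs]
    intro q _
    filter_upwards [Ioo_mem_nhdsLT (angle_lt q)] with r hr using hr.1
  obtain ⟨r, hr, hr'⟩ := (h₁.and (Ioo_mem_nhdsLT Real.two_pi_pos)).exists
  refine ⟨r, ?_⟩
  rwa [angle_coe hr'.1.le hr'.2]

variable (L) in
lemma image_level : L.level '' L.support_s5ᶜ =
    insert ⊥ ((fun p => (angle p : WithBot ℝ)) '' L.nonlast) := by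
  apply subset_antisymm
  · rintro _ ⟨x, -, rfl⟩
    rcases level_eq_bot_or (L := L) x with h | ⟨p, q, h, hr, hp, hq⟩
    · exact Or.inl h
    · exact Or.inr ⟨p, ⟨q, hr, hp.trans hq⟩, h.symm⟩
  · rintro _ (rfl | ⟨p, ⟨q, hr, hpq⟩, rfl⟩)
    · obtain ⟨x, hx⟩ := exists_angle_after_all L.support_finite
      refine ⟨x, fun h => (hx x h).false, ?_⟩
      rcases level_eq_bot_or (L := L) x with h | ⟨p, q, h, hr, hp, hq⟩
      · exact h
      · have hne : p ≠ q := fun h => (hp.trans hq).ne (congrArg angle h)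
        exact absurd (hx q (mem_support_right_s5 hr hne)) (not_lt.2 hq.le)
    · obtain ⟨x, hpx, hx⟩ := exists_angle_just_after L.support_finite p
      refine ⟨x, fun h => (hx x h hpx).false, ?_⟩
      have hne : p ≠ q := fun h => hpq.ne (congrArg angle h)
      refine le_antisymm ?_ (angle_le_level hr hpx (hx q (mem_support_right_s5 hr hne) hpq))
      rcases level_eq_bot_or (L := L) x with h | ⟨p', q', h, hr', hp', hq'⟩
      · simp [h]
      · rw [h]
        by_contra! hlt
        exact absurd (hx p' (nonlast_subset_support ⟨q', hr', hp'.trans hq'⟩)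
          (WithBot.coe_lt_coe.1 hlt)) (not_lt.2 hp'.le)

lemma cls_eq_cls_iff {x y : Circle2pi} : L.cls x = L.cls y ↔ L.rel x y := by
  constructor
  · intro h
    have : y ∈ L.cls y := L.iseqv.refl y
    rwa [← h] at this
  · intro h
    ext z
    exact ⟨fun hz => L.iseqv.trans (L.iseqv.symm h) hz, fun hz => L.iseqv.trans h hz⟩

lemma mem_support_of_rel {x y : Circle2pi} (h : L.rel x y) (hx : x ∈ L.support_s5) :
    y ∈ L.support_s5 := by
  by_cases hxy : x = y
  · rwa [← hxy]
  · exact mem_support_right_s5 h hxy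

variable (L) in
lemma ncard_nonlast_add_ncard_cls :
    L.nonlast.ncard + (L.cls '' L.support_s5).ncard = L.support_s5.ncard := by
  have himage : L.cls '' (L.support_s5 \ L.nonlast) = L.cls '' L.support_s5 := by
    apply subset_antisymm (image_mono sdiff_subset)
    rintro _ ⟨x, hx, rfl⟩
    obtain ⟨y, hy, hmax⟩ := Set.exists_max_image (L.cls x) angle (L.class_finite x)
      ⟨x, L.iseqv.refl x⟩
    refine ⟨y, ⟨mem_support_of_rel hy hx, ?_⟩, (cls_eq_cls_iff.2 hy).symm⟩
    rintro ⟨q, hr, hq⟩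
    exact absurd (hmax q (L.iseqv.trans hy hr)) (not_le.2 hq)
  have hinj : InjOn L.cls (L.support_s5 \ L.nonlast) := by
    intro x hx y hy h
    rw [cls_eq_cls_iff] at h
    refine angle_injective (le_antisymm ?_ ?_)
    · exact not_lt.1 fun hlt => hy.2 ⟨x, L.iseqv.symm h, hlt⟩
    · exact not_lt.1 fun hlt => hx.2 ⟨y, h, hlt⟩
  rw [← himage, hinj.ncard_image, add_comm]
  exact ncard_sdiff_add_ncard_of_subset nonlast_subset_support L.support_finite

/-- Two maps with the same fibers on `s` have images in bijection. -/
lemma exists_injOn_image_eq {α β γ : Type*} [Nonempty α] {s : Set α} {f : α → β} {g : α → γ}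
    (h : ∀ x ∈ s, ∀ y ∈ s, f x = f y ↔ g x = g y) :
    ∃ F : β → γ, InjOn F (f '' s) ∧ F '' (f '' s) = g '' s := by
  have hF : ∀ x ∈ s, g (Function.invFunOn f s (f x)) = g x := fun x hx =>
    (h _ (Function.invFunOn_apply_mem hx) _ hx).1 (Function.invFunOn_apply_eq hx)
  refine ⟨g ∘ Function.invFunOn f s, ?_, ?_⟩
  · rintro _ ⟨x, hx, rfl⟩ _ ⟨y, hy, rfl⟩ hxy
    simp only [Function.comp, hF x hx, hF y hy] at hxy
    exact (h x hx y hy).2 hxy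
  · rw [image_image]
    exact image_congr fun x hx => hF x hx

variable (L) in
lemma exists_injOn_gaps : ∃ F : Set Circle2pi → WithBot ℝ, InjOn F {G | IsGapOf L G} ∧
    F '' {G | IsGapOf L G} = L.level '' L.support_s5ᶜ := by
  rw [setOf_isGapOf_eq_image]
  exact exists_injOn_image_eq fun x hx y hy =>
    (gapOf_eq_gapOf_iff hy).trans (level_eq_iff hx hy).symm

variable (L) in
lemma finite_setOf_isGapOf : {G | IsGapOf L G}.Finite := by
  obtain ⟨F, hF, himage⟩ := L.exists_injOn_gaps
  refine Set.Finite.of_finite_image ?_ hF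
  rw [himage, image_level]
  exact ((L.support_finite.subset nonlast_subset_support).image _).insert _

/-- A lamination with `n` points in `k` nontrivial classes has `n - k + 1` gaps. -/
lemma ncard_isGapOf_add_ncard_cls (L : FiniteLamination) :
    {G | IsGapOf L G}.ncard + (L.cls '' L.support_s5).ncard = L.support_s5.ncard + 1 := by
  obtain ⟨F, hF, himage⟩ := L.exists_injOn_gaps
  have hfin := L.support_finite.subset nonlast_subset_support
  rw [← hF.ncard_image, himage, image_level, ncard_insert_of_notMem (by simp) (hfin.image _),
    ncard_image_of_injective _ (fun _ _ h => angle_injective (WithBot.coe_injective h)),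
    ← L.ncard_nonlast_add_ncard_cls]
  ring

lemma mem_gap_iff {G : Set Circle2pi} (hG : IsGapOf L G) {x : Circle2pi} :
    x ∈ G ↔ x ∉ L.support_s5 ∧ L.gapOf x = G := by
  obtain ⟨y, hy, rfl⟩ := isGapOf_iff.1 hG
  constructor
  · intro (hx : L.GapRel y x)
    exact ⟨gapRel_self_iff.1 (hx.symm.trans hx), (gapOf_eq_gapOf_iff hy).2 hx.symm⟩
  · rintro ⟨hx, h⟩
    rw [← h]
    exact gapRel_self_iff.2 hx

lemma closure_gap_subset {G : Set Circle2pi} (hG : IsGapOf L G) :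
    closure G ⊆ G ∪ L.support_s5 := by
  intro x hx
  by_cases hxs : x ∈ L.support_s5
  · exact Or.inr hxs
  · have hgap : IsGapOf L (L.gapOf x) := isGapOf_iff.2 ⟨x, hxs, rfl⟩
    obtain ⟨z, hzx, hz⟩ := mem_closure_iff.1 hx _ (isOpen_gapOf x) (gapRel_self_iff.2 hxs)
    left
    rw [mem_gap_iff hG]
    exact ⟨hxs, ((mem_gap_iff hgap).1 hzx).2.symm.trans ((mem_gap_iff hG).1 hz).2⟩

lemma disjoint_gaps {G K : Set Circle2pi} (hG : IsGapOf L G) (hK : IsGapOf L K) (h : G ≠ K) :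
    Disjoint G K := by
  rw [Set.disjoint_left]
  intro x hx hx'
  exact h (((mem_gap_iff hG).1 hx).2.symm.trans ((mem_gap_iff hK).1 hx').2)

/-! ### Summing over classes -/

lemma cls_eq_singleton {x : Circle2pi} (hx : x ∉ L.support_s5) : L.cls x = {x} := by
  ext y
  constructor
  · intro hy
    by_contra hne
    exact hx ⟨y, hy, hne⟩
  · rintro rfl
    exact L.iseqv.refl y

lemma ncard_cls_ne_zero (L : FiniteLamination) (x : Circle2pi) :
    ((L.cls x).ncard : ℝ) ≠ 0 := by
  have : (L.cls x).ncard ≠ 0 := ncard_ne_zero_of_mem (L.iseqv.refl x) (L.class_finite x)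
  exact_mod_cast this

open Classical in
lemma sum_support_div_ncard_cls (L : FiniteLamination) (w : Set Circle2pi → ℝ) :
    ∑ x ∈ L.support_finite.toFinset, w (L.cls x) / (L.cls x).ncard =
      ∑ A ∈ L.support_finite.toFinset.image L.cls, w A := by
  rw [Finset.sum_comp (fun A => w A / A.ncard) L.cls]
  refine Finset.sum_congr rfl fun A hA => ?_
  obtain ⟨x, hx, rfl⟩ := Finset.mem_image.1 hA
  rw [Set.Finite.mem_toFinset] at hx
  have hcard : ((L.support_finite.toFinset.filter fun a => L.cls a = L.cls x).card) =
      (L.cls x).ncard := by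
    rw [← ncard_coe_finset]
    congr 1
    ext y
    simp only [Finset.coe_filter, Set.Finite.mem_toFinset, mem_ofPred_eq]
    constructor
    · rintro ⟨-, h⟩
      exact cls_eq_cls_iff.1 h.symm
    · intro h
      exact ⟨mem_support_of_rel h hx, (cls_eq_cls_iff.2 h).symm⟩
  rw [hcard, nsmul_eq_mul]
  field_simp [L.ncard_cls_ne_zero x]

lemma sum_support_one_div_ncard_cls (L : FiniteLamination) :
    ∑ x ∈ L.support_finite.toFinset, 1 / ((L.cls x).ncard : ℝ) = (L.cls '' L.support_s5).ncard := by
  classical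
  have himage : L.cls '' L.support_s5 = L.support_finite.toFinset.image L.cls := by simp
  rw [L.sum_support_div_ncard_cls fun _ => 1, himage, ncard_coe_finset]
  simp

end FiniteLamination

namespace LamBranchedCover

variable {L₁ L₂ : FiniteLamination} (δ : LamBranchedCover L₁ L₂)

lemma image_cls (x : Circle2pi) : δ.map '' L₁.cls x = L₂.cls (δ.map x) := δ.maps_cls x

lemma preimage_support_subset : δ.map ⁻¹' L₂.support_s5 ⊆ L₁.support_s5 := by
  rintro x ⟨y, hy, hne⟩
  have hy : y ∈ L₂.cls (δ.map x) := hy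
  rw [← δ.image_cls] at hy
  obtain ⟨z, hz, rfl⟩ := hy
  exact ⟨z, hz, fun h => hne (h ▸ rfl)⟩

lemma measurePreserving_map : MeasurePreserving δ.map := by
  rcases δ.deg_pos.eq_or_lt with h | h
  · have hmap : δ.map = fun t => t + δ.shift := by
      funext t
      simp [map, ← h]
    rw [hmap]
    exact measurePreserving_add_right _ _
  · exact (AddCircle.ergodic_nsmul_add δ.shift h).toMeasurePreserving

lemma ncard_preimage_singleton (y : Circle2pi) : (δ.map ⁻¹' {y}).ncard = δ.deg := by
  have hd : 0 < δ.deg := δ.deg_pos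
  have hd' : (0 : ℝ) < δ.deg := by exact_mod_cast hd
  set T := 2 * Real.pi with hT
  have hTpos : 0 < T := Real.two_pi_pos
  obtain ⟨r, hr⟩ : ∃ r : ℝ, (r : Circle2pi) = y - δ.shift := ⟨_, coe_angle _⟩
  let x₀ : Circle2pi := ((r / δ.deg : ℝ) : Circle2pi)
  have hx₀ : δ.deg • x₀ = y - δ.shift := by
    rw [← hr, ← AddCircle.coe_nsmul, nsmul_eq_mul]
    congr 1
    field_simp
  let g : ℕ → Circle2pi := fun m => ((m / δ.deg * T : ℝ) : Circle2pi) + x₀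
  have himage : δ.map ⁻¹' {y} = g '' (Finset.range δ.deg) := by
    ext x
    have hiff : δ.map x = y ↔ δ.deg • (x - x₀) = 0 := by
      rw [nsmul_sub, hx₀, map, sub_eq_zero, eq_sub_iff_add_eq]
    rw [mem_preimage, mem_singleton_iff, hiff, AddCircle.nsmul_eq_zero_iff hd]
    simp only [Finset.coe_range, mem_image, mem_Iio, g, ← eq_sub_iff_add_eq]
    rfl
  have hinj : InjOn g (Finset.range δ.deg) := by
    have hmem : ∀ m ∈ Finset.range δ.deg, 0 ≤ (m / δ.deg * T : ℝ) ∧ (m / δ.deg * T : ℝ) < T := by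
      intro m hm
      have : (m : ℝ) < δ.deg := by exact_mod_cast Finset.mem_range.1 hm
      refine ⟨by positivity, ?_⟩
      exact mul_lt_of_lt_one_left hTpos ((div_lt_one hd').2 this)
    intro m hm n hn h
    have h := congrArg angle (add_right_cancel h)
    rw [angle_coe (hmem m hm).1 (hmem m hm).2, angle_coe (hmem n hn).1 (hmem n hn).2] at h
    have := mul_right_cancel₀ hTpos.ne' h
    have := (div_left_inj' hd'.ne').1 this
    exact_mod_cast this
  rw [himage, hinj.ncard_image, ncard_coe_finset, Finset.card_range]

open Classical in
lemma sum_comp_map (h : Circle2pi → ℝ) (hh : ∀ y ∉ L₂.support_s5, h y = 0) :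
    ∑ x ∈ L₁.support_finite.toFinset, h (δ.map x) =
      δ.deg * ∑ y ∈ L₂.support_finite.toFinset, h y := by
  set N := L₁.support_finite.toFinset
  set M := L₂.support_finite.toFinset
  have hsub : ∑ x ∈ N.filter (fun x => δ.map x ∈ M), h (δ.map x) = ∑ x ∈ N, h (δ.map x) := by
    refine Finset.sum_filter_of_ne fun x _ hne => ?_
    by_contra hx
    exact hne (hh _ (by simpa [M] using hx))
  rw [← hsub, ← Finset.sum_fiberwise_of_maps_to' (t := M) (g := δ.map) (f := h)
    (fun x hx => (Finset.mem_filter.1 hx).2), Finset.mul_sum]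
  refine Finset.sum_congr rfl fun y hy => ?_
  rw [Finset.sum_const, nsmul_eq_mul, ← δ.ncard_preimage_singleton y, ← ncard_coe_finset]
  congr 3
  ext x
  simp only [Finset.coe_filter, Finset.mem_filter, mem_ofPred_eq, mem_preimage, mem_singleton_iff]
  constructor
  · exact fun h => h.2
  · rintro rfl
    refine ⟨⟨?_, hy⟩, rfl⟩
    simp only [N, M, Set.Finite.mem_toFinset] at hy ⊢
    exact δ.preimage_support_subset hy

/-- The number of critical points carried by classes. -/
lemma finsum_class_degree_sub_one :
    ∑ᶠ A ∈ {A : Set Circle2pi | ∃ x : Circle2pi, A = L₁.cls x},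
        (((A.ncard : ℝ) / ((δ.map '' A).ncard : ℝ)) - 1) =
      L₁.support_s5.ncard - (L₁.cls '' L₁.support_s5).ncard
        - δ.deg * (L₂.support_s5.ncard - (L₂.cls '' L₂.support_s5).ncard) := by
  classical
  set w : Set Circle2pi → ℝ := fun A => (A.ncard : ℝ) / ((δ.map '' A).ncard : ℝ) - 1 with hw
  have hfin : ∑ᶠ A ∈ {A : Set Circle2pi | ∃ x : Circle2pi, A = L₁.cls x}, w A =
      ∑ A ∈ L₁.support_finite.toFinset.image L₁.cls, w A := by
    refine finsum_mem_eq_sum_of_inter_support_eq _ ?_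
    ext A
    simp only [mem_inter_iff, mem_ofPred_eq, Function.mem_support, Finset.coe_image, mem_image,
      Set.Finite.coe_toFinset]
    refine and_congr_left fun hA => ⟨?_, ?_⟩
    · rintro ⟨x, rfl⟩
      refine ⟨x, ?_, rfl⟩
      by_contra hx
      exact hA (by simp [hw, FiniteLamination.cls_eq_singleton hx])
    · rintro ⟨x, -, rfl⟩
      exact ⟨x, rfl⟩
  have hterm : ∀ x, w (L₁.cls x) / (L₁.cls x).ncard =
      (1 / ((L₂.cls (δ.map x)).ncard : ℝ) - 1) + 1 - 1 / ((L₁.cls x).ncard : ℝ) := by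
    intro x
    have h₁ := L₁.ncard_cls_ne_zero x
    have h₂ := L₂.ncard_cls_ne_zero (δ.map x)
    simp only [hw, δ.image_cls]
    field_simp
    ring
  rw [hfin, ← L₁.sum_support_div_ncard_cls w, Finset.sum_congr rfl fun x _ => hterm x,
    Finset.sum_sub_distrib, Finset.sum_add_distrib, L₁.sum_support_one_div_ncard_cls,
    δ.sum_comp_map (fun y => 1 / ((L₂.cls y).ncard : ℝ) - 1)
      (fun y hy => by simp [FiniteLamination.cls_eq_singleton hy]),
    Finset.sum_sub_distrib, L₂.sum_support_one_div_ncard_cls]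
  simp only [Finset.sum_const, nsmul_eq_mul, mul_one,
    ← ncard_eq_toFinset_card _ L₁.support_finite, ← ncard_eq_toFinset_card _ L₂.support_finite]
  ring

/-- Up to the points in nontrivial classes, the preimage of a gap is the union of the gaps
lying over it. -/
lemma preimage_gap_diff_support {H : Set Circle2pi → Set Circle2pi}
    (hH : ∀ G, IsGapOf L₁ G → IsGapOf L₂ (H G) ∧ δ.map '' closure G = closure (H G))
    {K : Set Circle2pi} (hK : IsGapOf L₂ K) :
    δ.map ⁻¹' K \ L₁.support_s5 = ⋃ G ∈ {G | IsGapOf L₁ G ∧ H G = K}, G := by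
  have hmaps : ∀ G, IsGapOf L₁ G → ∀ x ∈ G, δ.map x ∈ H G := by
    intro G hG x hx
    have hcl : δ.map x ∈ closure (H G) :=
      (hH G hG).2 ▸ mem_image_of_mem _ (subset_closure hx)
    exact (FiniteLamination.closure_gap_subset (hH G hG).1 hcl).resolve_right
      fun h => ((FiniteLamination.mem_gap_iff hG).1 hx).1 (δ.preimage_support_subset h)
  ext x
  simp only [Set.mem_sdiff, mem_preimage, mem_iUnion, mem_ofPred_eq, exists_prop]
  constructor
  · rintro ⟨hxK, hx⟩
    have hG : IsGapOf L₁ (L₁.gapOf x) := FiniteLamination.isGapOf_iff.2 ⟨x, hx, rfl⟩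
    have hxG : x ∈ L₁.gapOf x := FiniteLamination.gapRel_self_iff.2 hx
    refine ⟨_, ⟨hG, ?_⟩, hxG⟩
    by_contra hne
    exact Set.disjoint_left.1 (FiniteLamination.disjoint_gaps (hH _ hG).1 hK hne)
      (hmaps _ hG x hxG) hxK
  · rintro ⟨G, ⟨hG, rfl⟩, hx⟩
    exact ⟨hmaps G hG x hx, ((FiniteLamination.mem_gap_iff hG).1 hx).1⟩

instance : NullSingletonClass (volume : Measure Circle2pi) where
  measure_singleton x := by
    rw [← Metric.closedBall_zero, AddCircle.volume_closedBall]
    simp [Real.two_pi_pos.le]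

open Classical in
lemma sum_volume_gaps_over {H : Set Circle2pi → Set Circle2pi}
    (hH : ∀ G, IsGapOf L₁ G → IsGapOf L₂ (H G) ∧ δ.map '' closure G = closure (H G))
    {K : Set Circle2pi} (hK : IsGapOf L₂ K) :
    ∑ G ∈ L₁.finite_setOf_isGapOf.toFinset.filter (fun G => H G = K), (volume G).toReal =
      (volume K).toReal := by
  set s := L₁.finite_setOf_isGapOf.toFinset.filter (fun G => H G = K) with hs
  have hmem : ∀ G, G ∈ s ↔ IsGapOf L₁ G ∧ H G = K := by simp [hs]
  have hunion : ⋃ G ∈ s, G = δ.map ⁻¹' K \ L₁.support_s5 := by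
    rw [δ.preimage_gap_diff_support hH hK]
    simp [hmem]
  have hdisj : (s : Set (Set Circle2pi)).PairwiseDisjoint id := fun G hG G' hG' hne =>
    FiniteLamination.disjoint_gaps ((hmem G).1 hG).1 ((hmem G').1 hG').1 hne
  have hmeas : ∀ G ∈ s, MeasurableSet (id G) := fun G hG => ((hmem G).1 hG).1.1.measurableSet
  calc ∑ G ∈ s, (volume G).toReal = volume.real (⋃ G ∈ s, id G) :=
        (measureReal_biUnion_finset hdisj hmeas).symm
    _ = volume.real (δ.map ⁻¹' K \ L₁.support_s5) := by rw [← hunion]; rfl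
    _ = (volume K).toReal := by
        rw [Measure.real, measure_sdiff_null (L₁.support_finite.measure_zero _),
          δ.measurePreserving_map.measure_preimage hK.1.measurableSet.nullMeasurableSet]

/-- The number of critical points carried by gaps. -/
lemma finsum_gap_degree_sub_one (gapDeg : Set Circle2pi → ℝ)
    (hgapDeg : ∀ G : Set Circle2pi, IsGapOf L₁ G →
      ∃ G' : Set Circle2pi, IsGapOf L₂ G' ∧ δ.map '' closure G = closure G' ∧
        gapDeg G = (δ.deg : ℝ) * (volume G).toReal / (volume G').toReal) :
    ∑ᶠ G ∈ {G : Set Circle2pi | IsGapOf L₁ G}, (gapDeg G - 1) =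
      δ.deg * {G | IsGapOf L₂ G}.ncard - {G | IsGapOf L₁ G}.ncard := by
  classical
  choose! H hH₂ hHcl hHdeg using hgapDeg
  have hH : ∀ G, IsGapOf L₁ G → IsGapOf L₂ (H G) ∧ δ.map '' closure G = closure (H G) :=
    fun G hG => ⟨hH₂ G hG, hHcl G hG⟩
  have hsum : ∑ G ∈ L₁.finite_setOf_isGapOf.toFinset, gapDeg G =
      ∑ K ∈ L₂.finite_setOf_isGapOf.toFinset, (δ.deg : ℝ) := by
    rw [← Finset.sum_fiberwise_of_maps_to (t := L₂.finite_setOf_isGapOf.toFinset) (g := H)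
      (fun G hG => by simpa using hH₂ G (by simpa using hG))]
    refine Finset.sum_congr rfl fun K hK => ?_
    have hK : IsGapOf L₂ K := by simpa using hK
    have hpos : (volume K).toReal ≠ 0 :=
      (ENNReal.toReal_pos (hK.1.measure_pos _ hK.2.1).ne' (measure_ne_top _ _)).ne'
    have hterm : ∀ G ∈ L₁.finite_setOf_isGapOf.toFinset.filter (fun G => H G = K),
        gapDeg G = δ.deg / (volume K).toReal * (volume G).toReal := by
      intro G hG
      simp only [Finset.mem_filter, Set.Finite.mem_toFinset, mem_ofPred_eq] at hG
      rw [hHdeg G hG.1, hG.2]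
      ring
    rw [Finset.sum_congr rfl hterm, ← Finset.mul_sum, δ.sum_volume_gaps_over hH hK,
      div_mul_cancel₀ _ hpos]
  rw [finsum_mem_eq_finite_toFinset_sum _ L₁.finite_setOf_isGapOf, Finset.sum_sub_distrib, hsum]
  simp only [Finset.sum_const, nsmul_eq_mul, mul_one,
    ← ncard_eq_toFinset_card _ L₁.finite_setOf_isGapOf,
    ← ncard_eq_toFinset_card _ L₂.finite_setOf_isGapOf]
  ring

end LamBranchedCover

/-- Riemann–Hurwitz count for lamination covers.  For a branched
covering `δ : L₁ → L₂` of degree `d`, the total number of critical points counted with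
multiplicity equals `d - 1`:
`Σ_A (deg(δ,A) - 1) + Σ_G (deg(δ,G) - 1) = d - 1`, where the first (finitely supported)
sum runs over all equivalence classes `A` of `L₁` with `deg(δ,A) = #A / #δ(A)`, and the
second over all gaps `G` of `L₁`, with `deg(δ,G) = d·μ(G)/μ(G')` for the gap `G'` of `L₂`
satisfying `δ(cl G) = cl G'`. -/
theorem lamination_cover_critical_point_count
    (L₁ L₂ : FiniteLamination) (δ : LamBranchedCover L₁ L₂)
    (gapDeg : Set Circle2pi → ℝ)
    (hgapDeg : ∀ G : Set Circle2pi, IsGapOf L₁ G →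
      ∃ G' : Set Circle2pi, IsGapOf L₂ G' ∧ δ.map '' closure G = closure G' ∧
        gapDeg G = (δ.deg : ℝ) * (volume G).toReal / (volume G').toReal) :
    (∑ᶠ A ∈ {A : Set Circle2pi | ∃ x : Circle2pi, A = L₁.cls x},
        (((A.ncard : ℝ) / ((δ.map '' A).ncard : ℝ)) - 1))
      + (∑ᶠ G ∈ {G : Set Circle2pi | IsGapOf L₁ G}, (gapDeg G - 1))
      = (δ.deg : ℝ) - 1 := by
  have h₁ : ({G | IsGapOf L₁ G}.ncard : ℝ) + (L₁.cls '' L₁.support_s5).ncard =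
      L₁.support_s5.ncard + 1 := by exact_mod_cast L₁.ncard_isGapOf_add_ncard_cls
  have h₂ : ({G | IsGapOf L₂ G}.ncard : ℝ) + (L₂.cls '' L₂.support_s5).ncard =
      L₂.support_s5.ncard + 1 := by exact_mod_cast L₂.ncard_isGapOf_add_ncard_cls
  rw [δ.finsum_class_degree_sub_one, δ.finsum_gap_degree_sub_one gapDeg hgapDeg]
  linear_combination (δ.deg : ℝ) * h₂ - h₁

end
end
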